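/- (Theorem 3) Fix δ ∈ (0,1) and an accuracy ε > (2BS/R₀)·‖P−Q‖_H, and set ε̄ := R₀ε/(2BS) and ε_pq := ε̄ − ‖P−Q‖_H > 0. Suppose λ_u > (1/(π·R²))·(log(2N/δ) − 2ε_pq²·m) and τ ≥ max(0, (1/(λ_r·(1−e^{−2ε_pq²})))·log(1/(1−Λ))), where Λ := (1/(λ_u·π·R²))·(log(2N/δ) − 2ε_pq²·m). Then, under the hierarchical request model with m source-domain samples, with probability at least 1−δ the following holds: every Π̂* ∈ Δ_N that minimizes T(·,p̂^{tl}) over Δ_N satisfies T(Π̂*,P) ≤ inf_{Π∈Δ_N} T(Π,P) + ε. -/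

import Mathlib

open MeasureTheory

/-- `g(x) := exp(-μ_s(1-x)^M)`, the per-file miss factor. -/
noncomputable def gmiss (μs : ℝ) (M : ℕ) (x : ℝ) : ℝ := Real.exp (-μs * (1 - x) ^ M)

/-- The probability simplex in `Fin N → ℝ`. -/
def simplexN (N : ℕ) : Set (Fin N → ℝ) := {c | (∀ i, 0 ≤ c i) ∧ ∑ i, c i = 1}

/-- Offloading loss `T(c,q) := (B/R₀)·Σ_i q_i·g(c_i)`. -/
noncomputable def offLoss (N : ℕ) (μs B R0 : ℝ) (M : ℕ) (c q : Fin N → ℝ) : ℝ :=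
  (B / R0) * ∑ i, q i * gmiss μs M (c i)

/-- `S := sup_{c ∈ Δ_N} Σ_i g(c_i)`. -/
noncomputable def Ssup (N : ℕ) (μs : ℝ) (M : ℕ) : ℝ :=
  sSup ((fun c => ∑ i, gmiss μs M (c i)) '' simplexN N)

/-- The transfer-learning estimator
`p̂^{tl}_i := (Σ_{l<n_p} 1{X_l=i} + Σ_k 1{Y_k=i})/(n_p+m)` (`:= 0` when `n_p+m = 0`). -/
noncomputable def tlProfile {Ω : Type*} (N m : ℕ) (nP : Ω → ℕ) (X : ℕ → Ω → Fin N)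
    (Y : Fin m → Ω → Fin N) (ω : Ω) (i : Fin N) : ℝ :=
  if nP ω + m = 0 then 0 else
    ((∑ l ∈ Finset.range (nP ω), if X l ω = i then (1 : ℝ) else 0) +
      ∑ k, (if Y k ω = i then (1 : ℝ) else 0)) / ((nP ω : ℝ) + m)

lemma aux_mgf {N : ℕ} (P : Fin N → ℝ) (hP : P ∈ simplexN N) (i : Fin N) (s : ℝ) :
    ∑ j, P j * Real.exp (s * ((if j = i then (1 : ℝ) else 0) - P i)) ≤ Real.exp (s ^ 2 / 8) := by
  let p : PMF (Fin N) := PMF.ofFintype (fun j => ENNReal.ofReal (P j)) (by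
    rw [← ENNReal.ofReal_sum_of_nonneg (fun j _ => hP.1 j), hP.2]; simp)
  have hp : ∀ j, (p j).toReal = P j := fun j => by
    simp [p, PMF.ofFintype_apply, ENNReal.toReal_ofReal (hP.1 j)]
  have h := ProbabilityTheory.hasSubgaussianMGF_of_mem_Icc (μ := p.toMeasure)
    (X := fun j => if j = i then (1 : ℝ) else 0) (a := 0) (b := 1)
    (Measurable.of_discrete).aemeasurable
    (Filter.Eventually.of_forall (fun j => by
      by_cases hj : j = i <;> simp [hj]))
  have hm := h.mgf_le s
  rw [ProbabilityTheory.mgf, PMF.integral_eq_sum, PMF.integral_eq_sum] at hm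
  simp only [hp, smul_eq_mul, mul_ite, mul_one, mul_zero, Finset.sum_ite_eq',
    Finset.sum_ite_eq, Finset.mem_univ, if_true] at hm
  refine hm.trans (le_of_eq ?_)
  congr 1
  norm_num
  ring

/-- Centered count. -/
noncomputable def Zc {N n m : ℕ} (P Q : Fin N → ℝ) (x : Fin n → Fin N) (y : Fin m → Fin N)
    (i : Fin N) : ℝ :=
  ∑ l, ((if x l = i then (1 : ℝ) else 0) - P i) + ∑ k, ((if y k = i then (1 : ℝ) else 0) - Q i)

lemma aux_prod {N n : ℕ} (P : Fin N → ℝ) (hP : P ∈ simplexN N) (i : Fin N) (s : ℝ) :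
    ∑ x : Fin n → Fin N, (∏ l, P (x l)) *
      Real.exp (s * ∑ l, ((if x l = i then (1 : ℝ) else 0) - P i)) ≤ Real.exp (n * (s ^ 2 / 8)) := by
  have : ∀ x : Fin n → Fin N, (∏ l, P (x l)) *
      Real.exp (s * ∑ l, ((if x l = i then (1 : ℝ) else 0) - P i)) =
      ∏ l, (P (x l) * Real.exp (s * ((if x l = i then (1 : ℝ) else 0) - P i))) := fun x => by
    rw [Finset.prod_mul_distrib, Finset.mul_sum, Real.exp_sum]
  simp_rw [this]
  rw [← Fintype.prod_sum (fun (_ : Fin n) j => P j * Real.exp (s * ((if j = i then (1 : ℝ) else 0) - P i)))]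
  rw [Finset.prod_const, Finset.card_univ, Fintype.card_fin, Real.exp_nat_mul]
  exact pow_le_pow_left₀ (Finset.sum_nonneg fun j _ => mul_nonneg (hP.1 j) (Real.exp_nonneg _))
    (aux_mgf P hP i s) n

lemma aux_Z {N n m : ℕ} (P Q : Fin N → ℝ) (hP : P ∈ simplexN N) (hQ : Q ∈ simplexN N)
    (i : Fin N) (s : ℝ) :
    ∑ z : (Fin n → Fin N) × (Fin m → Fin N), ((∏ l, P (z.1 l)) * ∏ k, Q (z.2 k)) *
      Real.exp (s * Zc P Q z.1 z.2 i) ≤ Real.exp (((n : ℝ) + m) * (s ^ 2 / 8)) := by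
  rw [Fintype.sum_prod_type]
  have : ∀ (x : Fin n → Fin N) (y : Fin m → Fin N), ((∏ l, P (x l)) * ∏ k, Q (y k)) *
      Real.exp (s * Zc P Q x y i) =
      ((∏ l, P (x l)) * Real.exp (s * ∑ l, ((if x l = i then (1 : ℝ) else 0) - P i))) *
      ((∏ l, Q (y l)) * Real.exp (s * ∑ l, ((if y l = i then (1 : ℝ) else 0) - Q i))) := by
    intro x y
    rw [Zc, mul_add, Real.exp_add]; ring
  simp_rw [this]
  rw [← Finset.sum_mul_sum, add_mul, Real.exp_add]
  refine mul_le_mul (aux_prod P hP i s) (aux_prod Q hQ i s) ?_ (Real.exp_nonneg _)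
  exact Finset.sum_nonneg fun j _ => mul_nonneg (Finset.prod_nonneg fun k _ => hQ.1 _)
    (Real.exp_nonneg _)

/-- bad samples -/
def badS {N : ℕ} (n m : ℕ) (P Q : Fin N → ℝ) (e : ℝ) :
    Set ((Fin n → Fin N) × (Fin m → Fin N)) :=
  {z | ∃ i, ((n : ℝ) + m) * e ≤ |Zc P Q z.1 z.2 i|}

open Classical in
lemma aux_tail {N n m : ℕ} (P Q : Fin N → ℝ) (hP : P ∈ simplexN N) (hQ : Q ∈ simplexN N)
    (e : ℝ) (he : 0 < e) :
    ∑ z : (Fin n → Fin N) × (Fin m → Fin N), (if z ∈ badS n m P Q e then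
      ((∏ l, P (z.1 l)) * ∏ k, Q (z.2 k)) else 0) ≤
      2 * N * Real.exp (-2 * ((n : ℝ) + m) * e ^ 2) := by
  set t : ℝ := ((n : ℝ) + m) with ht
  have hpt : ∀ z : (Fin n → Fin N) × (Fin m → Fin N), (if z ∈ badS n m P Q e then
      ((∏ l, P (z.1 l)) * ∏ k, Q (z.2 k)) else 0) ≤
      ∑ i, (Real.exp (-4 * t * e ^ 2) * (((∏ l, P (z.1 l)) * ∏ k, Q (z.2 k)) *
          Real.exp ((4 * e) * Zc P Q z.1 z.2 i)) +
        Real.exp (-4 * t * e ^ 2) * (((∏ l, P (z.1 l)) * ∏ k, Q (z.2 k)) *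
          Real.exp ((-(4 * e)) * Zc P Q z.1 z.2 i))) := by
    intro z
    have hw : 0 ≤ ((∏ l, P (z.1 l)) * ∏ k, Q (z.2 k)) :=
      mul_nonneg (Finset.prod_nonneg fun k _ => hP.1 _) (Finset.prod_nonneg fun k _ => hQ.1 _)
    set w := ((∏ l, P (z.1 l)) * ∏ k, Q (z.2 k))
    have hnn : ∀ i ∈ Finset.univ, 0 ≤ (Real.exp (-4 * t * e ^ 2) * (w *
          Real.exp ((4 * e) * Zc P Q z.1 z.2 i)) +
        Real.exp (-4 * t * e ^ 2) * (w * Real.exp ((-(4 * e)) * Zc P Q z.1 z.2 i))) :=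
      fun i _ => by positivity
    split_ifs with hz
    · obtain ⟨i, hi⟩ := hz
      refine le_trans ?_ (Finset.single_le_sum hnn (Finset.mem_univ i))
      have key : ∀ s : ℝ, 4 * t * e ^ 2 ≤ s → w ≤ Real.exp (-4 * t * e ^ 2) * (w * Real.exp s) := by
        intro s hs
        have : 1 ≤ Real.exp (-4 * t * e ^ 2) * Real.exp s := by
          rw [← Real.exp_add]; exact Real.one_le_exp (by linarith)
        nlinarith
      have hp : ∀ s : ℝ, 0 ≤ Real.exp (-4 * t * e ^ 2) * (w * Real.exp s) := fun s => by positivity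
      rcases le_abs.1 hi with h | h
      · have := key (4 * e * Zc P Q z.1 z.2 i) (by nlinarith)
        linarith [hp (-(4 * e) * Zc P Q z.1 z.2 i)]
      · have := key (-(4 * e) * Zc P Q z.1 z.2 i) (by nlinarith)
        linarith [hp ((4 * e) * Zc P Q z.1 z.2 i)]
    · exact Finset.sum_nonneg hnn
  refine (Finset.sum_le_sum fun z _ => hpt z).trans ?_
  rw [Finset.sum_comm]
  have hi : ∀ i : Fin N, ∑ z : (Fin n → Fin N) × (Fin m → Fin N),
      (Real.exp (-4 * t * e ^ 2) * (((∏ l, P (z.1 l)) * ∏ k, Q (z.2 k)) *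
          Real.exp ((4 * e) * Zc P Q z.1 z.2 i)) +
        Real.exp (-4 * t * e ^ 2) * (((∏ l, P (z.1 l)) * ∏ k, Q (z.2 k)) *
          Real.exp ((-(4 * e)) * Zc P Q z.1 z.2 i))) ≤ 2 * Real.exp (-2 * t * e ^ 2) := by
    intro i
    rw [Finset.sum_add_distrib, ← Finset.mul_sum, ← Finset.mul_sum]
    have h1 := mul_le_mul_of_nonneg_left (aux_Z (n := n) (m := m) P Q hP hQ i (4 * e))
      (Real.exp_nonneg (-4 * t * e ^ 2))
    have h2 := mul_le_mul_of_nonneg_left (aux_Z (n := n) (m := m) P Q hP hQ i (-(4 * e)))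
      (Real.exp_nonneg (-4 * t * e ^ 2))
    rw [← Real.exp_add, ← ht] at h1 h2
    have e1 : -4 * t * e ^ 2 + t * ((4 * e) ^ 2 / 8) = -2 * t * e ^ 2 := by ring
    have e2 : -4 * t * e ^ 2 + t * ((-(4 * e)) ^ 2 / 8) = -2 * t * e ^ 2 := by ring
    rw [e1] at h1
    rw [e2] at h2
    linarith
  refine (Finset.sum_le_sum fun i _ => hi i).trans (le_of_eq ?_)
  simp
  ring

lemma aux_tsum {f : ℕ → ℝ} {a : ℝ} (hf : ∀ n, 0 ≤ f n) (h : HasSum f a) :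
    ∑' n, ENNReal.ofReal (f n) = ENNReal.ofReal a := by
  rw [← ENNReal.ofReal_tsum_of_nonneg hf h.summable, h.tsum_eq]

lemma aux_pois (a r C : ℝ) :
    HasSum (fun n : ℕ => C * (Real.exp (-a) * a ^ n / (Nat.factorial n : ℝ) * r ^ n))
      (C * Real.exp (-(a * (1 - r)))) := by
  have h := (NormedSpace.expSeries_div_hasSum_exp (a * r)).mul_left (C * Real.exp (-a))
  rw [← Real.exp_eq_exp_ℝ] at h
  have e1 : (fun n : ℕ => C * (Real.exp (-a) * a ^ n / (Nat.factorial n : ℝ) * r ^ n)) =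
      fun n : ℕ => C * Real.exp (-a) * ((a * r) ^ n / (Nat.factorial n : ℝ)) := by
    funext n; rw [mul_pow]; ring
  have e2 : C * Real.exp (-(a * (1 - r))) = C * Real.exp (-a) * Real.exp (a * r) := by
    rw [mul_assoc, ← Real.exp_add]; ring_nf
  rw [e1, e2]
  exact h

lemma aux_g {N : ℕ} {μs : ℝ} (hμs : 0 < μs) (M : ℕ) (c : Fin N → ℝ) (hc : c ∈ simplexN N) :
    ∑ i, gmiss μs M (c i) ≤ Ssup N μs M := by
  apply le_csSup
  · refine ⟨N, ?_⟩
    rintro _ ⟨c, hc, rfl⟩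
    have : ∀ i ∈ Finset.univ, gmiss μs M (c i) ≤ 1 := by
      intro i _
      have h1 : c i ≤ 1 := hc.2 ▸ Finset.single_le_sum (fun j _ => hc.1 j) (Finset.mem_univ i)
      have : 0 ≤ (1 - c i) ^ M := pow_nonneg (by linarith) M
      rw [gmiss, Real.exp_le_one_iff]
      nlinarith
    simpa using Finset.sum_le_sum this
  · exact ⟨c, hc, rfl⟩

lemma aux_det {N : ℕ} {μs B R0 : ℝ} (hμs : 0 < μs) (hB : 0 < B) (hR0 : 0 < R0) (M : ℕ)
    (c : Fin N → ℝ) (hc : c ∈ simplexN N) (p q : Fin N → ℝ) (η : ℝ) (hη : 0 ≤ η)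
    (h : ∀ i, |q i - p i| ≤ η) :
    |offLoss N μs B R0 M c q - offLoss N μs B R0 M c p| ≤ B / R0 * (η * Ssup N μs M) := by
  rw [offLoss, offLoss, ← mul_sub, ← Finset.sum_sub_distrib, abs_mul, abs_of_pos (div_pos hB hR0)]
  refine mul_le_mul_of_nonneg_left ?_ (div_pos hB hR0).le
  refine (Finset.abs_sum_le_sum_abs _ _).trans ?_
  refine le_trans ?_ (mul_le_mul_of_nonneg_left (aux_g hμs M c hc) hη)
  rw [Finset.mul_sum]
  refine Finset.sum_le_sum fun i _ => ?_
  have hg : 0 ≤ gmiss μs M (c i) := Real.exp_nonneg _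
  rw [← sub_mul, abs_mul, abs_of_nonneg hg]
  exact mul_le_mul_of_nonneg_right (h i) hg

lemma aux_Zeq {N n m : ℕ} (P Q : Fin N → ℝ) (x : ℕ → Fin N) (y : Fin m → Fin N) (i : Fin N) :
    (∑ l ∈ Finset.range n, if x l = i then (1 : ℝ) else 0) +
      ∑ k, (if y k = i then (1 : ℝ) else 0) =
    Zc P Q (fun l : Fin n => x l) y i + n * P i + m * Q i := by
  rw [Zc, Finset.sum_sub_distrib, Finset.sum_sub_distrib, Finset.sum_range]
  simp
  ring

lemma aux_prof {N : ℕ} {Ω : Type*} (m : ℕ) (P Q : Fin N → ℝ) (nP : Ω → ℕ) (X : ℕ → Ω → Fin N)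
    (Y : Fin m → Ω → Fin N) (ω : Ω) (e : ℝ)
    (h : ((fun l : Fin (nP ω) => X l ω), (fun k => Y k ω)) ∉ badS (nP ω) m P Q e) (i : Fin N) :
    |tlProfile N m nP X Y ω i - P i| ≤ e + ⨆ j, |P j - Q j| := by
  set n := nP ω with hn
  have hz : |Zc P Q (fun l : Fin n => X l ω) (fun k => Y k ω) i| < ((n : ℝ) + m) * e := by
    by_contra hcon
    exact h ⟨i, not_lt.1 hcon⟩
  have hpos : n + m ≠ 0 := by
    intro h0
    have : ((n : ℝ) + m) = 0 := by exact_mod_cast h0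
    rw [this, zero_mul] at hz
    exact absurd hz (not_lt.2 (abs_nonneg _))
  have hpos' : (0 : ℝ) < (n : ℝ) + m := by exact_mod_cast Nat.pos_of_ne_zero hpos
  have hd : |P i - Q i| ≤ ⨆ j, |P j - Q j| :=
    le_ciSup (f := fun j => |P j - Q j|) (Set.finite_range _).bddAbove i
  rw [tlProfile, ← hn, if_neg hpos, aux_Zeq P Q (fun l => X l ω) (fun k => Y k ω) i]
  have : (Zc P Q (fun l : Fin n => X l ω) (fun k => Y k ω) i + n * P i + m * Q i) / ((n : ℝ) + m) - P i
      = (Zc P Q (fun l : Fin n => X l ω) (fun k => Y k ω) i - m * (P i - Q i)) / ((n : ℝ) + m) := by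
    field_simp; ring
  rw [this, abs_div, abs_of_pos hpos', div_le_iff₀ hpos']
  refine (abs_sub _ _).trans ?_
  rw [abs_mul, Nat.abs_cast]
  have hm : (0 : ℝ) ≤ m := Nat.cast_nonneg m
  have hn' : (0 : ℝ) ≤ n := Nat.cast_nonneg n
  have hd0 := abs_nonneg (P i - Q i)
  nlinarith [mul_le_mul_of_nonneg_left hd hm, mul_nonneg hn' (hd0.trans hd)]

open Classical in
lemma aux_bad {N : ℕ} {Ω : Type*} [MeasurableSpace Ω] (Pr : Measure Ω) (m : ℕ)
    (P Q : Fin N → ℝ) (hP : P ∈ simplexN N) (hQ : Q ∈ simplexN N)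
    (nR nP : Ω → ℕ) (X : ℕ → Ω → Fin N) (Y : Fin m → Ω → Fin N) (e : ℝ) (he : 0 < e)
    (L a : ℝ) (hL : 0 ≤ L) (ha : 0 ≤ a)
    (hjoint : ∀ k n : ℕ, Pr {ω | nR ω = k ∧ nP ω = n} =
      ENNReal.ofReal
        ((Real.exp (-L) * L ^ k / (Nat.factorial k : ℝ)) *
          (Real.exp (-((k : ℝ) * a)) * ((k : ℝ) * a) ^ n / (Nat.factorial n : ℝ))))
    (hcondiid : ∀ (n : ℕ) (x : Fin n → Fin N) (y : Fin m → Fin N),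
      Pr {ω | nP ω = n ∧ (∀ l : Fin n, X l ω = x l) ∧ ∀ k, Y k ω = y k} =
        Pr {ω | nP ω = n} * (∏ l, ENNReal.ofReal (P (x l))) *
          ∏ k, ENNReal.ofReal (Q (y k))) :
    Pr {ω | ((fun l : Fin (nP ω) => X l ω), (fun k => Y k ω)) ∈ badS (nP ω) m P Q e} ≤
      ENNReal.ofReal (2 * N * Real.exp (-2 * m * e ^ 2) *
        Real.exp (-(L * (1 - Real.exp (-(a * (1 - Real.exp (-2 * e ^ 2)))))))) := by
  set r := Real.exp (-2 * e ^ 2) with hr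
  set C := 2 * N * Real.exp (-2 * m * e ^ 2) with hC
  have hC0 : 0 ≤ C := by positivity
  have hr0 : 0 ≤ r := Real.exp_nonneg _
  have hsub : {ω | ((fun l : Fin (nP ω) => X l ω), (fun k => Y k ω)) ∈ badS (nP ω) m P Q e} ⊆
      ⋃ n : ℕ, ⋃ z ∈ (Finset.univ.filter (· ∈ badS n m P Q e)),
        {ω | nP ω = n ∧ (∀ l : Fin n, X l ω = z.1 l) ∧ ∀ k, Y k ω = z.2 k} := by
    intro ω hω
    simp only [Set.mem_iUnion]
    exact ⟨nP ω, ((fun l : Fin (nP ω) => X l ω), (fun k => Y k ω)),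
      Finset.mem_filter.2 ⟨Finset.mem_univ _, hω⟩, rfl, fun _ => rfl, fun _ => rfl⟩
  have hn : ∀ n : ℕ, Pr (⋃ z ∈ (Finset.univ.filter (· ∈ badS n m P Q e)),
        {ω | nP ω = n ∧ (∀ l : Fin n, X l ω = z.1 l) ∧ ∀ k, Y k ω = z.2 k}) ≤
      ∑' k : ℕ, ENNReal.ofReal (C * (Real.exp (-L) * L ^ k / (Nat.factorial k : ℝ)) *
          (Real.exp (-((k : ℝ) * a)) * ((k : ℝ) * a) ^ n / (Nat.factorial n : ℝ) * r ^ n)) := by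
    intro n
    have h1 : Pr {ω | nP ω = n} ≤ ∑' k : ℕ, Pr {ω | nR ω = k ∧ nP ω = n} := by
      refine le_trans (measure_mono ?_) (measure_iUnion_le _)
      intro ω hω
      exact Set.mem_iUnion.2 ⟨nR ω, rfl, hω⟩
    refine (measure_biUnion_finset_le _ _).trans ?_
    have h2 : ∀ z : (Fin n → Fin N) × (Fin m → Fin N),
        Pr {ω | nP ω = n ∧ (∀ l : Fin n, X l ω = z.1 l) ∧ ∀ k, Y k ω = z.2 k} =
        Pr {ω | nP ω = n} * ENNReal.ofReal ((∏ l, P (z.1 l)) * ∏ k, Q (z.2 k)) := by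
      intro z
      rw [hcondiid, ENNReal.ofReal_mul (Finset.prod_nonneg fun k _ => hP.1 _),
        ENNReal.ofReal_prod_of_nonneg (fun k _ => hP.1 _),
        ENNReal.ofReal_prod_of_nonneg (fun k _ => hQ.1 _), mul_assoc]
    simp_rw [h2]
    rw [← Finset.mul_sum, ← ENNReal.ofReal_sum_of_nonneg (fun z _ =>
      mul_nonneg (Finset.prod_nonneg fun k _ => hP.1 _) (Finset.prod_nonneg fun k _ => hQ.1 _)),
      Finset.sum_filter]
    refine (mul_le_mul' h1 (ENNReal.ofReal_le_ofReal (aux_tail P Q hP hQ e he))).trans ?_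
    rw [← ENNReal.tsum_mul_right]
    refine ENNReal.tsum_le_tsum fun k => ?_
    rw [hjoint, ← ENNReal.ofReal_mul (by positivity)]
    refine ENNReal.ofReal_le_ofReal (le_of_eq ?_)
    have : Real.exp (-2 * ((n : ℝ) + m) * e ^ 2) = Real.exp (-2 * m * e ^ 2) * r ^ n := by
      rw [hr, ← Real.exp_nat_mul, ← Real.exp_add]; ring_nf
    rw [this, hC]; ring
  refine (measure_mono hsub).trans ((measure_iUnion_le _).trans ?_)
  refine (ENNReal.tsum_le_tsum hn).trans ?_
  rw [ENNReal.tsum_comm]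
  refine le_of_eq ?_
  have h3 : ∀ k : ℕ, ∑' n : ℕ, ENNReal.ofReal (C * (Real.exp (-L) * L ^ k / (Nat.factorial k : ℝ)) *
          (Real.exp (-((k : ℝ) * a)) * ((k : ℝ) * a) ^ n / (Nat.factorial n : ℝ) * r ^ n)) =
      ENNReal.ofReal (C * (Real.exp (-L) * L ^ k / (Nat.factorial k : ℝ) *
        Real.exp (-(a * (1 - r))) ^ k)) := by
    intro k
    rw [aux_tsum (fun n => by positivity) (aux_pois ((k : ℝ) * a) r _)]
    congr 1
    rw [← Real.exp_nat_mul, mul_assoc C]; ring_nf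
  simp_rw [h3]
  exact aux_tsum (fun n => by positivity) (aux_pois L _ C)

/-- Theorem 3: under the hierarchical request model with `m`
source-domain samples from `Q`, for an accuracy `ε > (2BS/R₀)·‖P-Q‖_H`, with
`ε̄ := R₀ε/(2BS)`, `ε_pq := ε̄ - ‖P-Q‖_H`, if
`λ_u > (1/(πR²))·(log(2N/δ) - 2ε_pq²m)` and
`τ ≥ max(0, (1/(λ_r(1-e^{-2ε_pq²})))·log(1/(1-Λ)))` with
`Λ := (1/(λ_u π R²))·(log(2N/δ) - 2ε_pq²m)`, then with probability at least `1-δ`,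
every minimizer `ĉ` of `T(·,p̂^{tl})` over the simplex satisfies
`T(ĉ,P) ≤ inf_{c ∈ Δ_N} T(c,P) + ε`. -/
theorem theorem3 (N : ℕ) (hN : 1 ≤ N) (μs B R0 : ℝ)
    (hμs : 0 < μs) (hB : 0 < B) (hR0 : 0 < R0) (M : ℕ) (hM : 1 ≤ M)
    (P Q : Fin N → ℝ) (hP : P ∈ simplexN N) (hQ : Q ∈ simplexN N)
    (lamU lamR R τ ε δ : ℝ) (hlamU : 0 < lamU) (hlamR : 0 < lamR) (hR : 0 < R)
    (hτ0 : 0 ≤ τ) (hδ0 : 0 < δ) (hδ1 : δ < 1) (m : ℕ)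
    (hε : (2 * B * Ssup N μs M / R0) * (⨆ j, |P j - Q j|) < ε)
    {Ω : Type*} [MeasurableSpace Ω] (Pr : Measure Ω) [IsProbabilityMeasure Pr]
    (nR nP : Ω → ℕ) (X : ℕ → Ω → Fin N) (Y : Fin m → Ω → Fin N)
    (hX : ∀ l, Measurable (X l)) (hY : ∀ k, Measurable (Y k))
    (hjoint : ∀ k n : ℕ, Pr {ω | nR ω = k ∧ nP ω = n} =
      ENNReal.ofReal
        ((Real.exp (-(lamU * Real.pi * R ^ 2)) * (lamU * Real.pi * R ^ 2) ^ k /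
            (Nat.factorial k : ℝ)) *
          (Real.exp (-((k : ℝ) * (lamR * τ))) * ((k : ℝ) * (lamR * τ)) ^ n /
            (Nat.factorial n : ℝ))))
    (hcondiid : ∀ (n : ℕ) (x : Fin n → Fin N) (y : Fin m → Fin N),
      Pr {ω | nP ω = n ∧ (∀ l : Fin n, X l ω = x l) ∧ ∀ k, Y k ω = y k} =
        Pr {ω | nP ω = n} * (∏ l, ENNReal.ofReal (P (x l))) *
          ∏ k, ENNReal.ofReal (Q (y k)))
    (hlamU' : (1 / (Real.pi * R ^ 2)) *
        (Real.log (2 * N / δ) -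
          2 * (R0 * ε / (2 * B * Ssup N μs M) - ⨆ j, |P j - Q j|) ^ 2 * m) < lamU)
    (hτ : max 0
        ((1 / (lamR * (1 - Real.exp
            (-2 * (R0 * ε / (2 * B * Ssup N μs M) - ⨆ j, |P j - Q j|) ^ 2)))) *
          Real.log (1 / (1 - (1 / (lamU * Real.pi * R ^ 2)) *
            (Real.log (2 * N / δ) -
              2 * (R0 * ε / (2 * B * Ssup N μs M) - ⨆ j, |P j - Q j|) ^ 2 * m)))) ≤ τ) :
    ENNReal.ofReal (1 - δ) ≤
      Pr {ω | ∀ chat ∈ simplexN N,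
        (∀ c' ∈ simplexN N,
          offLoss N μs B R0 M chat (tlProfile N m nP X Y ω) ≤
            offLoss N μs B R0 M c' (tlProfile N m nP X Y ω)) →
        offLoss N μs B R0 M chat P ≤
          sInf ((fun c => offLoss N μs B R0 M c P) '' simplexN N) + ε} := by
  classical
  set S := Ssup N μs M with hS
  set d := ⨆ j, |P j - Q j| with hd
  set e := R0 * ε / (2 * B * S) - d with he
  have hS0 : 0 < S := by
    refine lt_of_lt_of_le ?_ (aux_g hμs M P hP)
    haveI : Nonempty (Fin N) := ⟨⟨0, hN⟩⟩
    exact Finset.sum_pos (fun i _ => Real.exp_pos _) Finset.univ_nonempty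
  have hd0 : 0 ≤ d := Real.iSup_nonneg fun j => abs_nonneg _
  have he0 : 0 < e := by
    rw [he, sub_pos, lt_div_iff₀ (by positivity)]
    rw [div_mul_eq_mul_div, div_lt_iff₀ hR0] at hε
    linarith
  set L := lamU * Real.pi * R ^ 2 with hLdef
  have hL0 : 0 < L := by have := Real.pi_pos; positivity
  have hbad := aux_bad Pr m P Q hP hQ nR nP X Y e he0 L (lamR * τ) hL0.le
    (mul_nonneg hlamR.le hτ0) hjoint hcondiid
  have hN0 : (0 : ℝ) < N := by exact_mod_cast hN
  set W := Real.log (2 * N / δ) - 2 * e ^ 2 * m with hW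
  have hWL : W < L := by
    rw [one_div, inv_mul_lt_iff₀ (by have := Real.pi_pos; positivity)] at hlamU'
    rw [hLdef]; linarith
  have hLam : 0 < 1 - 1 / L * W := by
    rw [one_div, sub_pos, inv_mul_lt_iff₀ hL0]; linarith
  have hs : 0 < 1 - Real.exp (-2 * e ^ 2) := by
    rw [sub_pos, Real.exp_lt_one_iff]; nlinarith [pow_pos he0 2]
  have hτ1 := (le_max_right _ _).trans hτ
  have hexp : Real.exp (-(lamR * τ * (1 - Real.exp (-2 * e ^ 2)))) ≤ 1 - 1 / L * W := by
    rw [one_div (1 - 1 / L * W), Real.log_inv, one_div (lamR * _),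
      inv_mul_le_iff₀ (mul_pos hlamR hs)] at hτ1
    rw [← Real.le_log_iff_exp_le hLam]
    linarith
  have hfin : 2 * N * Real.exp (-2 * m * e ^ 2) *
        Real.exp (-(L * (1 - Real.exp (-(lamR * τ * (1 - Real.exp (-2 * e ^ 2))))))) ≤ δ := by
    have h1 : -(L * (1 - Real.exp (-(lamR * τ * (1 - Real.exp (-2 * e ^ 2)))))) ≤ -W := by
      have : L * (1 / L * W) = W := by field_simp
      nlinarith
    have h2 := Real.exp_le_exp.2 h1
    have h3 : 2 * N * Real.exp (-2 * m * e ^ 2) * Real.exp (-W) = δ := by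
      rw [mul_assoc, ← Real.exp_add]
      have : -2 * m * e ^ 2 + -W = - Real.log (2 * N / δ) := by rw [hW]; ring
      rw [this, Real.exp_neg, Real.exp_log (by positivity)]
      field_simp
    rw [← h3]
    exact mul_le_mul_of_nonneg_left h2 (by positivity)
  have hbad' := hbad.trans (ENNReal.ofReal_le_ofReal hfin)
  set G := {ω | ∀ chat ∈ simplexN N,
        (∀ c' ∈ simplexN N,
          offLoss N μs B R0 M chat (tlProfile N m nP X Y ω) ≤
            offLoss N μs B R0 M c' (tlProfile N m nP X Y ω)) →
        offLoss N μs B R0 M chat P ≤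
          sInf ((fun c => offLoss N μs B R0 M c P) '' simplexN N) + ε} with hG
  set Bd := {ω | ((fun l : Fin (nP ω) => X l ω), (fun k => Y k ω)) ∈ badS (nP ω) m P Q e} with hBd
  have hcov : (Set.univ : Set Ω) ⊆ G ∪ Bd := by
    intro ω _
    by_cases hω : ω ∈ Bd
    · exact Or.inr hω
    · left
      intro chat hchat hmin
      have hprof := aux_prof m P Q nP X Y ω e hω
      have hη : 0 ≤ e + d := by linarith
      have heps : B / R0 * ((e + d) * S) = ε / 2 := by
        rw [he]; field_simp; ring
      rw [← sub_le_iff_le_add]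
      refine le_csInf ⟨_, P, hP, rfl⟩ ?_
      rintro _ ⟨c, hc, rfl⟩
      have h1 := abs_le.1 (aux_det hμs hB hR0 M chat hchat P _ (e + d) hη hprof)
      have h2 := abs_le.1 (aux_det hμs hB hR0 M c hc P _ (e + d) hη hprof)
      have h3 := hmin c hc
      rw [← hS, heps] at h1 h2
      simp only
      linarith [h1.1, h2.2]
  have h1 : (1 : ENNReal) ≤ Pr G + ENNReal.ofReal δ := by
    calc (1 : ENNReal) = Pr Set.univ := measure_univ.symm
      _ ≤ Pr (G ∪ Bd) := measure_mono hcov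
      _ ≤ Pr G + Pr Bd := measure_union_le _ _
      _ ≤ _ := by gcongr
  rw [ENNReal.ofReal_sub _ hδ0.le, ENNReal.ofReal_one]
  exact tsub_le_iff_right.2 h1
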